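/- Let ϱ be a 2-dimensional density matrix (a qubit state) with S(ϱ) < 1/2. Then for every ε > 0 there exists a 2-dimensional density matrix ϱ' of full rank with 0 < S(ϱ') < ε, a finite-dimensional quasi-classical density matrix σ (diagonal in a fixed orthonormal basis {|j⟩}), and a unitary U on the joint space of the two qubits and the catalyst, such that tr_C[U((ϱ ⊗ ϱ) ⊗ σ)U†] = ϱ' ⊗ 𝟙₂ and D[tr_{1,2}[U((ϱ ⊗ ϱ) ⊗ σ)U†]] = σ, where 𝟙₂ is the maximally mixed qubit state, tr_C traces out the catalyst, tr_{1,2} traces out the two qubits, and D is the dephasing channel in the basis {|j⟩}. -/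

import Mathlib

open scoped Kronecker ComplexOrder
open Matrix

noncomputable section

/-- `ρ` is a density matrix: positive semidefinite with unit trace. -/
def IsDensityMatrix {ι : Type*} [Fintype ι] (ρ : Matrix ι ι ℂ) : Prop :=
  ρ.PosSemidef ∧ ρ.trace = 1

/-- Partial trace over the second tensor factor. -/
def ptrace2 {ι κ : Type*} [Fintype κ] (M : Matrix (ι × κ) (ι × κ) ℂ) : Matrix ι ι ℂ :=
  Matrix.of fun i j => ∑ k, M (i, k) (j, k)

/-- Partial trace over the first tensor factor. -/
def ptrace1 {ι κ : Type*} [Fintype ι] (M : Matrix (ι × κ) (ι × κ) ℂ) : Matrix κ κ ℂ :=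
  Matrix.of fun i j => ∑ k, M (k, i) (k, j)

/-- Dephasing (decoherence) channel in the fixed (standard) orthonormal basis `{|j⟩}`:
`D[σ] = ∑ j ⟨j|σ|j⟩ |j⟩⟨j|`. -/
def deph {ι : Type*} [DecidableEq ι] (M : Matrix ι ι ℂ) : Matrix ι ι ℂ :=
  Matrix.diagonal fun j => M j j

/-- The eigenvalue list of a matrix (junk value `0` if not Hermitian). -/
def eigs {ι : Type*} [Fintype ι] [DecidableEq ι] (ρ : Matrix ι ι ℂ) : ι → ℝ :=
  if h : ρ.IsHermitian then h.eigenvalues else 0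

/-- The spectrum of a matrix, as a multiset of real eigenvalues (with multiplicity). -/
def spectra {ι : Type*} [Fintype ι] [DecidableEq ι] (ρ : Matrix ι ι ℂ) : Multiset ℝ :=
  Finset.univ.val.map (eigs ρ)

/-- von Neumann entropy `S(ρ) = -tr(ρ log ρ)`, i.e. the Shannon entropy
of the eigenvalue list (natural logarithm). -/
def vN {ι : Type*} [Fintype ι] [DecidableEq ι] (ρ : Matrix ι ι ℂ) : ℝ :=
  ∑ i, Real.negMulLog (eigs ρ i)

/-- Maximally mixed state `𝟙_d = (1/d)·I_d`. -/
def mm (d : ℕ) : Matrix (Fin d) (Fin d) ℂ :=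
  (d : ℂ)⁻¹ • (1 : Matrix (Fin d) (Fin d) ℂ)

/-- von Neumann entropy in bits (base-2 logarithm). -/
def vN2 {ι : Type*} [Fintype ι] [DecidableEq ι] (ρ : Matrix ι ι ℂ) : ℝ :=
  ∑ i, -(eigs ρ i * Real.logb 2 (eigs ρ i))

/-- `p` is a probability vector. -/
def IsProb {A : Type*} [Fintype A] (p : A → ℝ) : Prop :=
  (∀ x, 0 ≤ p x) ∧ ∑ x, p x = 1

/-- The distribution `p` can be turned into `q` by a permutation acting jointly with a catalyst
whose marginal distribution is returned unchanged (but possibly correlated with the system). -/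
def CatConv {A : Type*} [Fintype A] (p q : A → ℝ) : Prop :=
  ∃ (C : Type) (_ : Fintype C) (c : C → ℝ) (e : Equiv.Perm (A × C)), IsProb c ∧
    (∀ x, ∑ j, p (e (x, j)).1 * c (e (x, j)).2 = q x) ∧
    (∀ j, ∑ x, p (e (x, j)).1 * c (e (x, j)).2 = c j)

/-- The factor for cell `i` of the hybrid distribution whose first `k` cells are fresh copies
of `p` while the remaining ones hold the entries of `v`. -/
def hybridFactor {A : Type*} [DecidableEq A] {n : ℕ} (p : A → ℝ) (v : Fin n → A) (k : ℕ)
    (i : Fin n) (a : A) : ℝ :=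
  if (i : ℕ) < k then p a else if a = v i then 1 else 0

/-- The hybrid distribution: the first `k` cells are fresh independent copies of `p`, the
remaining ones follow the corresponding marginal of `χ`. -/
def hybrid {A : Type*} [Fintype A] [DecidableEq A] {n : ℕ} (p : A → ℝ) (χ : (Fin n → A) → ℝ)
    (k : ℕ) (w : Fin n → A) : ℝ :=
  ∑ v, χ v * ∏ i, hybridFactor p v k i (w i)

section hybrid

variable {A : Type*} [Fintype A] [DecidableEq A] {n : ℕ}

lemma sum_hybridFactor {p : A → ℝ} (hp : IsProb p) (v : Fin n → A) (k : ℕ) (i : Fin n) :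
    ∑ a, hybridFactor p v k i a = 1 := by
  unfold hybridFactor
  split_ifs
  · exact hp.2
  · simp

lemma sum_prod_hybridFactor {p : A → ℝ} (hp : IsProb p) (v : Fin n → A) (k : ℕ) :
    ∑ w : Fin n → A, ∏ i, hybridFactor p v k i (w i) = 1 := by
  have h := Finset.sum_prod_piFinset (ι := Fin n) (Finset.univ : Finset A) (hybridFactor p v k)
  rw [Fintype.piFinset_univ] at h
  rw [h]
  exact Finset.prod_eq_one fun i _ => sum_hybridFactor hp v k i

lemma isProb_hybrid {p : A → ℝ} (hp : IsProb p) {χ : (Fin n → A) → ℝ} (hχ : IsProb χ) (k : ℕ) :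
    IsProb (hybrid p χ k) := by
  refine ⟨fun w => Finset.sum_nonneg fun v _ => mul_nonneg (hχ.1 v)
    (Finset.prod_nonneg fun i _ => ?_), ?_⟩
  · unfold hybridFactor
    split_ifs
    · exact hp.1 _
    · exact zero_le_one
    · exact le_rfl
  · unfold hybrid
    rw [Finset.sum_comm, ← hχ.2]
    refine Finset.sum_congr rfl fun v _ => ?_
    rw [← Finset.mul_sum, sum_prod_hybridFactor hp, mul_one]

lemma hybrid_zero (p : A → ℝ) (χ : (Fin n → A) → ℝ) : hybrid p χ 0 = χ := by
  funext w
  unfold hybrid hybridFactor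
  rw [Finset.sum_eq_single w]
  · simp
  · intro v _ hv
    obtain ⟨i, hi⟩ := Function.ne_iff.1 hv
    rw [Finset.prod_eq_zero (Finset.mem_univ i), mul_zero]
    simp [hi.symm]
  · simp

lemma hybrid_self (p : A → ℝ) {χ : (Fin n → A) → ℝ} (hχ : IsProb χ) (w : Fin n → A) :
    hybrid p χ n w = ∏ i, p (w i) := by
  simp [hybrid, hybridFactor, ← Finset.sum_mul, hχ.2]

lemma mul_hybrid_update (p : A → ℝ) (χ : (Fin n → A) → ℝ) (k : Fin n) (w : Fin n → A) (x : A) :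
    p (w k) * hybrid p χ k (Function.update w k x) =
      ∑ v, (χ v * if x = v k then 1 else 0) * ∏ i, hybridFactor p v (k + 1) i (w i) := by
  unfold hybrid
  rw [Finset.mul_sum]
  refine Finset.sum_congr rfl fun v _ => ?_
  rw [Fintype.prod_eq_mul_prod_compl k, Fintype.prod_eq_mul_prod_compl k]
  have h : ∏ i ∈ {k}ᶜ, hybridFactor p v k i (Function.update w k x i) =
      ∏ i ∈ {k}ᶜ, hybridFactor p v (k + 1) i (w i) := by
    refine Finset.prod_congr rfl fun i hi => ?_
    have hik : i ≠ k := by simpa using hi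
    have hlt : (i : ℕ) < k ↔ (i : ℕ) < k + 1 := by
      have := Fin.val_ne_of_ne hik
      omega
    simp [hybridFactor, Function.update_of_ne hik, hlt]
  rw [h]
  simp only [hybridFactor, Function.update_self, lt_irrefl, Nat.lt_succ_self, if_true, if_false]
  ring

lemma sum_mul_hybrid_update (p : A → ℝ) (χ : (Fin n → A) → ℝ) (k : Fin n) (w : Fin n → A) :
    ∑ x, p (w k) * hybrid p χ k (Function.update w k x) = hybrid p χ (k + 1) w := by
  simp_rw [mul_hybrid_update]
  rw [Finset.sum_comm]
  refine Finset.sum_congr rfl fun v _ => ?_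
  rw [← Finset.sum_mul, ← Finset.mul_sum]
  simp

lemma sum_mul_hybrid_update' {p : A → ℝ} (hp : IsProb p) (χ : (Fin n → A) → ℝ) (k : Fin n)
    (x : A) :
    ∑ w : Fin n → A, p (w k) * hybrid p χ k (Function.update w k x) =
      ∑ v, χ v * if x = v k then 1 else 0 := by
  simp_rw [mul_hybrid_update]
  rw [Finset.sum_comm]
  refine Finset.sum_congr rfl fun v _ => ?_
  rw [← Finset.mul_sum, sum_prod_hybridFactor hp, mul_one]

end hybrid

lemma IsProb.pi {A : Type*} [Fintype A] {p : A → ℝ} (hp : IsProb p) (n : ℕ) :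
    IsProb fun w : Fin n → A => ∏ i, p (w i) :=
  ⟨fun _ => Finset.prod_nonneg fun _ _ => hp.1 _, by rw [← Fintype.sum_pow, hp.2, one_pow]⟩

lemma IsProb.comp_equiv {A B : Type*} [Fintype A] [Fintype B] {p : A → ℝ} (hp : IsProb p)
    (e : B ≃ A) : IsProb (p ∘ e) :=
  ⟨fun _ => hp.1 _, by rw [← hp.2]; exact e.sum_comp p⟩

/-- Swapping the system with the cell selected by the counter. -/
def swapCell {A : Type*} {n : ℕ} : Equiv.Perm (A × (Fin n × (Fin n → A))) :=
  Function.Involutive.toPerm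
    (fun y => (y.2.2 y.2.1, (y.2.1, Function.update y.2.2 y.2.1 y.1)))
    (fun y => by simp)

lemma swapCell_apply {A : Type*} {n : ℕ} (x : A) (k : Fin n) (w : Fin n → A) :
    swapCell (x, (k, w)) = (w k, (k, Function.update w k x)) := rfl

/-- A joint permutation of `N + 1` copies of `p` yields a catalytic conversion of a single copy
into the average of the single-cell marginals of the permuted distribution. -/
lemma catConv_average {A : Type} [Fintype A] [DecidableEq A] {p : A → ℝ} (hp : IsProb p) (N : ℕ)
    (π : Equiv.Perm (Fin (N + 1) → A)) :
    CatConv p fun x => ((N : ℝ) + 1)⁻¹ *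
      ∑ k, ∑ v : Fin (N + 1) → A, (∏ i, p (π v i)) * if x = v k then 1 else 0 := by
  set χ : (Fin (N + 1) → A) → ℝ := (fun w => ∏ i, p (w i)) ∘ π
  have hχ : IsProb χ := (hp.pi (N + 1)).comp_equiv π
  let rot : Equiv.Perm (Fin (N + 1) × (Fin (N + 1) → A)) :=
    Equiv.prodShear (Equiv.subRight 1) fun k => if k = 0 then π else Equiv.refl _
  have hN : (0 : ℝ) < (N : ℝ) + 1 := by positivity
  refine ⟨Fin (N + 1) × (Fin (N + 1) → A), inferInstance,
    fun j => ((N : ℝ) + 1)⁻¹ * hybrid p χ j.1 j.2,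
    (Equiv.prodCongr (Equiv.refl A) rot).trans swapCell, ⟨?_, ?_⟩, ?_, ?_⟩
  · exact fun j => mul_nonneg (by positivity) ((isProb_hybrid hp hχ _).1 _)
  · rw [← Finset.mul_sum, Fintype.sum_prod_type]
    simp only [(isProb_hybrid hp hχ _).2]
    simp
    field_simp
  · intro x
    have := Equiv.sum_comp rot fun j => p (j.2 j.1) *
      (((N : ℝ) + 1)⁻¹ * hybrid p χ j.1 (Function.update j.2 j.1 x))
    refine Eq.trans this ?_
    rw [Fintype.sum_prod_type]
    beta_reduce
    rw [Finset.mul_sum]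
    refine Finset.sum_congr rfl fun k _ => ?_
    simp_rw [mul_left_comm _ ((N : ℝ) + 1)⁻¹]
    rw [← Finset.mul_sum, sum_mul_hybrid_update' hp]
    rfl
  · rintro ⟨k, w⟩
    have key : ∑ x, p ((rot (k, w)).2 (rot (k, w)).1) * (((N : ℝ) + 1)⁻¹ *
        hybrid p χ (rot (k, w)).1 (Function.update (rot (k, w)).2 (rot (k, w)).1 x)) =
        ((N : ℝ) + 1)⁻¹ * hybrid p χ k w := by
      simp_rw [mul_left_comm _ ((N : ℝ) + 1)⁻¹]
      rw [← Finset.mul_sum, sum_mul_hybrid_update]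
      congr 1
      cases k using Fin.cases with
      | zero =>
        have h1 : (rot (0, w)).1 = Fin.last N := by
          change (0 : Fin (N + 1)) - 1 = Fin.last N
          rw [sub_eq_iff_eq_add]; simp
        have h2 : (rot (0, w)).2 = π w := by simp [rot, Equiv.prodShear]
        rw [h1, h2, Fin.val_last, hybrid_self p hχ, Fin.val_zero, hybrid_zero]
        rfl
      | succ j =>
        have h1 : (rot (j.succ, w)).1 = j.castSucc := by
          change j.succ - 1 = j.castSucc
          rw [sub_eq_iff_eq_add]; simp
        have h2 : (rot (j.succ, w)).2 = w := by
          simp [rot, Equiv.prodShear, Fin.succ_ne_zero]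
        rw [h1, h2]
        simp
    exact key

/-- Adding independent noise, drawn from the catalyst, to the output of a catalytic
conversion. -/
lemma CatConv.convolve {A : Type} [Fintype A] [AddGroup A] {p q : A → ℝ} (h : CatConv p q)
    {d : A → ℝ} (hd : IsProb d) : CatConv p fun x => ∑ z, q (x - z) * d z := by
  obtain ⟨C, _, c, e, hc, hA, hC⟩ := h
  let noise : Equiv.Perm (A × (C × A)) :=
    (Equiv.prodAssoc A C A).symm.trans
      (((Equiv.prodComm (A × C) A).trans ((Equiv.prodShear (Equiv.refl A)
        fun z => (Equiv.prodCongr (Equiv.subRight z) (Equiv.refl C)).trans e).trans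
        (Equiv.prodComm A (A × C)))).trans (Equiv.prodAssoc A C A))
  have hnoise : ∀ x j z, noise (x, (j, z)) = ((e (x - z, j)).1, ((e (x - z, j)).2, z)) :=
    fun _ _ _ => rfl
  refine ⟨C × A, inferInstance, fun y => c y.1 * d y.2, noise, ⟨?_, ?_⟩, ?_, ?_⟩
  · exact fun y => mul_nonneg (hc.1 _) (hd.1 _)
  · rw [Fintype.sum_prod_type]
    simp only [← Finset.mul_sum, hd.2, mul_one, hc.2]
  · intro x
    rw [Fintype.sum_prod_type, Finset.sum_comm]
    refine Finset.sum_congr rfl fun z _ => ?_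
    rw [← hA, Finset.sum_mul]
    refine Finset.sum_congr rfl fun j _ => ?_
    simp only [hnoise]
    ring
  · rintro ⟨j, z⟩
    simp only [hnoise]
    rw [← hC j, Finset.sum_mul, ← Equiv.sum_comp (Equiv.addRight z)]
    refine Finset.sum_congr rfl fun x _ => ?_
    simp only [Equiv.coe_addRight, add_sub_cancel_right]
    ring

/-- Chernoff bound: the sequences of probability less than `2⁻ⁿ` have exponentially small total
probability as soon as `2⁻ˢ ∑ₓ p(x)¹⁻ˢ` is small. -/
lemma sum_atypical_le {A : Type*} [Fintype A] {p : A → ℝ} (hp : ∀ x, 0 ≤ p x) (n : ℕ)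
    {s : ℝ} (hs : 0 < s) (hs1 : s < 1) :
    ∑ w : Fin n → A, (if (2⁻¹ : ℝ) ^ n ≤ ∏ i, p (w i) then 0 else ∏ i, p (w i)) ≤
      ((2⁻¹ : ℝ) ^ s * ∑ x, p x ^ (1 - s)) ^ n := by
  rw [mul_pow, Fintype.sum_pow, Finset.mul_sum]
  refine Finset.sum_le_sum fun w _ => ?_
  have hP : 0 ≤ ∏ i, p (w i) := Finset.prod_nonneg fun i _ => hp _
  rw [Real.finsetProd_rpow _ _ fun i _ => hp _]
  have h2 : ((2⁻¹ : ℝ) ^ s) ^ n = ((2⁻¹ : ℝ) ^ n) ^ s := by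
    rw [← Real.rpow_natCast, ← Real.rpow_natCast, ← Real.rpow_mul (by norm_num),
      ← Real.rpow_mul (by norm_num), mul_comm]
  rw [h2]
  split_ifs with h
  · positivity
  · calc ∏ i, p (w i) = (∏ i, p (w i)) ^ s * (∏ i, p (w i)) ^ (1 - s) := by
          rw [← Real.rpow_add_of_nonneg hP hs.le (by linarith)]
          simp
      _ ≤ _ := by
          gcongr
          exact (not_le.1 h).le

/-- At most `2ⁿ` sequences have probability at least `2⁻ⁿ`. -/
lemma card_typical_le {A : Type*} [Fintype A] {p : A → ℝ} (hp : IsProb p) (n : ℕ) :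
    Fintype.card {w : Fin n → A // (2⁻¹ : ℝ) ^ n ≤ ∏ i, p (w i)} ≤ 2 ^ n := by
  classical
  rw [Fintype.card_subtype]
  set T := Finset.univ.filter fun w : Fin n → A => (2⁻¹ : ℝ) ^ n ≤ ∏ i, p (w i)
  have h1 : T.card • (2⁻¹ : ℝ) ^ n ≤ ∑ w ∈ T, ∏ i, p (w i) :=
    Finset.card_nsmul_le_sum _ _ _ fun w hw => (Finset.mem_filter.1 hw).2
  have h2 : ∑ w ∈ T, ∏ i, p (w i) ≤ 1 := by
    rw [← (hp.pi n).2]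
    exact Finset.sum_le_sum_of_subset_of_nonneg (Finset.subset_univ _)
      fun w _ _ => (hp.pi n).1 w
  have h3 : (T.card : ℝ) ≤ 2 ^ n := by
    rw [nsmul_eq_mul, inv_pow] at h1
    have := h1.trans h2
    rwa [← div_eq_mul_inv, div_le_one (by positivity)] at this
  exact_mod_cast h3

/-- Compression: a permutation of the sequences of bit pairs that sends every sequence of
probability at least `2⁻ⁿ` to one whose first bits all vanish. -/
lemma exists_compression {p : Fin 2 × Fin 2 → ℝ} (hp : IsProb p) (n : ℕ) :
    ∃ π : Equiv.Perm (Fin n → Fin 2 × Fin 2), ∀ v, (2⁻¹ : ℝ) ^ n ≤ ∏ i, p (v i) →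
      ∀ i, (π v i).1 = 0 := by
  classical
  let f : (Fin n → Fin 2) ↪ (Fin n → Fin 2 × Fin 2) :=
    ⟨fun g i => (0, g i), fun g g' h => funext fun i => by simpa using congrFun h i⟩
  have hcard : Fintype.card {w : Fin n → Fin 2 × Fin 2 // (2⁻¹ : ℝ) ^ n ≤ ∏ i, p (w i)} ≤
      Fintype.card (Fin n → Fin 2) := by
    simpa using card_typical_le hp n
  obtain ⟨g⟩ := Function.Embedding.nonempty_of_card_le hcard
  let h := g.trans f
  let e := Equiv.ofInjective h h.injective
  refine ⟨Equiv.extendSubtype (q := fun w => w ∈ Set.range h) e, fun v hv i => ?_⟩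
  obtain ⟨u, hu⟩ := Equiv.extendSubtype_mem (q := fun w => w ∈ Set.range h) e v hv
  rw [← hu]
  rfl

/-- A bit pair satisfying the Chernoff condition can be catalytically converted into a pair
consisting of an almost deterministic bit and an unconstrained one. -/
lemma exists_catConv_small {p : Fin 2 × Fin 2 → ℝ} (hp : IsProb p) {s : ℝ} (hs : 0 < s)
    (hs1 : s < 1) (hlt : (2⁻¹ : ℝ) ^ s * ∑ x, p x ^ (1 - s) < 1) {η : ℝ} (hη : 0 < η) :
    ∃ q, IsProb q ∧ CatConv p q ∧ ∑ z, q (1, z) < η := by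
  set r := (2⁻¹ : ℝ) ^ s * ∑ x, p x ^ (1 - s)
  have hr0 : 0 ≤ r := mul_nonneg (by positivity)
    (Finset.sum_nonneg fun x _ => Real.rpow_nonneg (hp.1 x) _)
  obtain ⟨N, hN⟩ := exists_pow_lt_of_lt_one hη hlt
  obtain ⟨π, hπ⟩ := exists_compression hp (N + 1)
  have hN1 : (0 : ℝ) < (N : ℝ) + 1 := by positivity
  refine ⟨_, ⟨fun x => ?_, ?_⟩, catConv_average hp N π.symm, ?_⟩
  · refine mul_nonneg (by positivity) (Finset.sum_nonneg fun k _ => Finset.sum_nonneg fun v _ =>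
      mul_nonneg (Finset.prod_nonneg fun i _ => hp.1 _) ?_)
    split_ifs <;> norm_num
  · rw [← Finset.mul_sum, Finset.sum_comm]
    have h : ∀ k : Fin (N + 1), ∑ x, ∑ v : Fin (N + 1) → Fin 2 × Fin 2,
        (∏ i, p (π.symm v i)) * (if x = v k then 1 else 0) = 1 := by
      intro k
      rw [Finset.sum_comm]
      refine Eq.trans (Finset.sum_congr rfl fun v _ => ?_) ((hp.pi (N + 1)).comp_equiv π.symm).2
      rw [← Finset.mul_sum]
      simp
    simp only [h]
    simp
    field_simp
  · refine lt_of_le_of_lt ?_ hN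
    refine le_trans ?_ (pow_le_pow_of_le_one hr0 hlt.le N.le_succ)
    refine le_trans ?_ (sum_atypical_le hp.1 (N + 1) hs hs1)
    set t := ∑ w : Fin (N + 1) → Fin 2 × Fin 2,
      (if (2⁻¹ : ℝ) ^ (N + 1) ≤ ∏ i, p (w i) then 0 else ∏ i, p (w i)) with ht
    have h : ∀ k : Fin (N + 1), ∑ z, ∑ v : Fin (N + 1) → Fin 2 × Fin 2,
        (∏ i, p (π.symm v i)) * (if ((1 : Fin 2), z) = v k then 1 else 0) ≤ t := by
      intro k
      rw [Finset.sum_comm, ← Equiv.sum_comp π, ht]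
      refine Finset.sum_le_sum fun v _ => ?_
      rw [← Finset.mul_sum, Equiv.symm_apply_apply]
      split_ifs with hv
      · have h0 := hπ v hv k
        refine (mul_eq_zero_of_right _ (Finset.sum_eq_zero fun z _ => if_neg fun h1 => ?_)).le
        simp [← h1] at h0
      · refine mul_le_of_le_one_right (Finset.prod_nonneg fun i _ => hp.1 _) ?_
        by_cases h1 : 1 = (π v k).1 <;> simp [Prod.ext_iff, h1]
    rw [← Finset.mul_sum, Finset.sum_comm, inv_mul_le_iff₀ hN1]
    refine (Finset.sum_le_sum fun k _ => h k).trans ?_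
    simp

lemma hasDerivAt_rpow_one_sub {a : ℝ} (ha : 0 ≤ a) :
    HasDerivAt (fun s : ℝ => a ^ (1 - s)) (-(a * Real.log a)) 0 := by
  rcases ha.eq_or_lt with rfl | ha
  · have h : (fun s : ℝ => (0 : ℝ) ^ (1 - s)) =ᶠ[nhds 0] fun _ => 0 := by
      filter_upwards [gt_mem_nhds (zero_lt_one' ℝ)] with s hs
      exact Real.zero_rpow (by linarith)
    simpa using (hasDerivAt_const (0 : ℝ) (0 : ℝ)).congr_of_eventuallyEq h
  · have h := ((hasDerivAt_id (0 : ℝ)).const_sub 1).const_rpow ha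
    simpa [mul_comm] using h

/-- Two independent bits of total entropy below one bit satisfy the hypothesis of the Chernoff
bound `sum_atypical_le`. -/
lemma exists_chernoff_exponent {l : Fin 2 → ℝ} (hl : IsProb l)
    (hS : ∑ i, -(l i * Real.logb 2 (l i)) < 1 / 2) :
    ∃ s : ℝ, 0 < s ∧ s < 1 ∧
      (2⁻¹ : ℝ) ^ s * ∑ x : Fin 2 × Fin 2, (l x.1 * l x.2) ^ (1 - s) < 1 := by
  have hlog : (0 : ℝ) < Real.log 2 := Real.log_pos (by norm_num)
  have hsum : l 0 + l 1 = 1 := by simpa using hl.2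
  have hent : -(l 0 * Real.log (l 0)) - l 1 * Real.log (l 1) < Real.log 2 / 2 := by
    have h := mul_lt_mul_of_pos_right hS hlog
    simp only [Fin.sum_univ_two, Real.logb] at h
    field_simp at h
    linarith
  have h2 : HasDerivAt (fun s : ℝ => (2⁻¹ : ℝ) ^ s) (-Real.log 2) 0 := by
    simpa using (hasDerivAt_id (0 : ℝ)).const_rpow (a := (2⁻¹ : ℝ)) (by norm_num)
  have hg := h2.mul (((hasDerivAt_rpow_one_sub (hl.1 0)).add
    (hasDerivAt_rpow_one_sub (hl.1 1))).pow 2)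
  have hslope := (hasDerivAt_iff_tendsto_slope.1 hg).mono_left
    (nhdsGT_le_nhdsNE 0)
  have hneg := hslope.eventually_lt_const (u := 0) (by simp [hsum]; linarith)
  obtain ⟨s, ⟨hs, hs1⟩, hs0⟩ := ((hneg.and (nhdsWithin_le_nhds
    (gt_mem_nhds (zero_lt_one' ℝ)))).and self_mem_nhdsWithin).exists
  refine ⟨s, hs0, hs1, ?_⟩
  rw [slope_def_field, sub_zero, div_lt_iff₀ hs0, zero_mul, sub_neg] at hs
  simp only [Pi.mul_apply, Pi.pow_apply, Pi.add_apply, sub_zero, Real.rpow_zero, Real.rpow_one,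
    hsum, one_pow, mul_one] at hs
  refine lt_of_eq_of_lt ?_ hs
  simp only [Fintype.sum_prod_type, Fin.sum_univ_two, Real.mul_rpow (hl.1 _) (hl.1 _)]
  ring

/-- Catalytic cooling of classical bit pairs. -/
lemma exists_catConv_cool {p : Fin 2 × Fin 2 → ℝ} (hp : IsProb p) {s : ℝ} (hs : 0 < s)
    (hs1 : s < 1) (hlt : (2⁻¹ : ℝ) ^ s * ∑ x, p x ^ (1 - s) < 1) {η : ℝ} (hη : 0 < η) :
    ∃ y, 0 < y ∧ y < η ∧ CatConv p fun x => (if x.1 = 0 then 1 - y else y) / 2 := by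
  obtain ⟨q, hq, hpq, hsmall⟩ := exists_catConv_small hp hs hs1 hlt (half_pos hη)
  obtain ⟨δ, hδ0, hδ⟩ := exists_between (lt_min (half_pos hη) one_half_pos)
  obtain ⟨hδη, hδ1⟩ := lt_min_iff.1 hδ
  let d : Fin 2 × Fin 2 → ℝ := fun z => (if z.1 = 0 then 1 - δ else δ) / 2
  have hd : IsProb d := by
    refine ⟨fun z => ?_, ?_⟩
    · simp only [d]
      split_ifs <;> linarith
    · simp [d, Fintype.sum_prod_type]
  have hsum := hq.2
  simp only [Fintype.sum_prod_type, Fin.sum_univ_two] at hsum hsmall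
  have h00 := hq.1 (0, 0)
  have h01 := hq.1 (0, 1)
  have h10 := hq.1 (1, 0)
  have h11 := hq.1 (1, 1)
  refine ⟨(q (1, 0) + q (1, 1)) * (1 - δ) + (q (0, 0) + q (0, 1)) * δ, ?_, ?_, ?_⟩
  · nlinarith
  · nlinarith
  · convert hpq.convolve hd using 1
    funext ⟨i, j⟩
    have hneg : (-1 : Fin 2) = 1 := rfl
    have hcond : q (0, 0) = 1 - q (0, 1) - q (1, 0) - q (1, 1) := by linarith
    fin_cases i <;> fin_cases j <;>
      simp [d, Fintype.sum_prod_type, hneg, hcond] <;> ring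

lemma IsProb.isDensityMatrix_diagonal {A : Type*} [Fintype A] [DecidableEq A] {p : A → ℝ}
    (hp : IsProb p) : IsDensityMatrix (diagonal fun x => (p x : ℂ)) := by
  refine ⟨PosSemidef.diagonal fun x => ?_, ?_⟩
  · exact Complex.zero_le_real.2 (hp.1 x)
  · rw [trace_diagonal]
    exact_mod_cast hp.2

lemma ptrace2_diagonal {ι κ : Type*} [Fintype κ] [DecidableEq ι] [DecidableEq κ]
    (f : ι × κ → ℂ) : ptrace2 (diagonal f) = diagonal fun i => ∑ k, f (i, k) := by
  ext i j
  by_cases h : i = j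
  · subst h; simp [ptrace2]
  · simp [ptrace2, h]

lemma ptrace1_diagonal {ι κ : Type*} [Fintype ι] [DecidableEq ι] [DecidableEq κ]
    (f : ι × κ → ℂ) : ptrace1 (diagonal f) = diagonal fun j => ∑ k, f (k, j) := by
  ext i j
  by_cases h : i = j
  · subst h; simp [ptrace1]
  · simp [ptrace1, h]

/-- A Hermitian matrix is unitarily diagonalizable. -/
lemma Matrix.IsHermitian.exists_unitary_diagonal {ι : Type*} [Fintype ι] [DecidableEq ι]
    {ϱ : Matrix ι ι ℂ} (h : ϱ.IsHermitian) :
    ∃ V ∈ Matrix.unitaryGroup ι ℂ, ϱ = V * diagonal (fun i => (h.eigenvalues i : ℂ)) * Vᴴ :=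
  ⟨h.eigenvectorUnitary, h.eigenvectorUnitary.2, by
    conv_lhs => rw [h.spectral_theorem, Unitary.conjStarAlgAut_apply]
    rfl⟩

/-- A classical catalytic conversion of eigenvalue distributions lifts to a unitary one. -/
lemma CatConv.exists_unitary {A : Type} [Fintype A] [DecidableEq A] {p q : A → ℝ}
    (h : CatConv p q) {ϱ V : Matrix A A ℂ} (hV : V ∈ Matrix.unitaryGroup A ℂ)
    (hϱ : ϱ = V * diagonal (fun x => (p x : ℂ)) * Vᴴ) :
    ∃ (m : ℕ) (σ : Matrix (Fin m) (Fin m) ℂ), IsDensityMatrix σ ∧ deph σ = σ ∧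
      ∃ U ∈ Matrix.unitaryGroup (A × Fin m) ℂ,
        ptrace2 (U * (ϱ ⊗ₖ σ) * Uᴴ) = diagonal (fun x => (q x : ℂ)) ∧
        deph (ptrace1 (U * (ϱ ⊗ₖ σ) * Uᴴ)) = σ := by
  obtain ⟨C, _, c, e, hc, hA, hC⟩ := h
  let f := (Fintype.equivFin C).symm
  let g : Equiv.Perm (A × Fin (Fintype.card C)) :=
    ((Equiv.prodCongr (Equiv.refl A) f).trans e).trans (Equiv.prodCongr (Equiv.refl A) f.symm)
  have hg : ∀ x j, g (x, j) = ((e (x, f j)).1, f.symm (e (x, f j)).2) := fun _ _ => rfl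
  set σ : Matrix (Fin (Fintype.card C)) (Fin (Fintype.card C)) ℂ :=
    diagonal fun j => ((c (f j) : ℝ) : ℂ) with hσ
  have hdeph : ∀ r : Fin (Fintype.card C) → ℂ, deph (diagonal r) = diagonal r := by
    intro r; simp [deph]
  let W : Matrix (A × Fin (Fintype.card C)) (A × Fin (Fintype.card C)) ℂ := V ⊗ₖ 1
  have hW : Wᴴ * W = 1 :=
    Unitary.star_mul_self_of_mem (Matrix.kronecker_mem_unitary hV (one_mem _))
  have hM : ϱ ⊗ₖ σ = W * (diagonal (fun x => (p x : ℂ)) ⊗ₖ σ) * Wᴴ := by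
    simp only [W, conjTranspose_kronecker, conjTranspose_one, ← mul_kronecker_mul, one_mul,
      mul_one, ← hϱ]
  let U : Matrix (A × Fin (Fintype.card C)) (A × Fin (Fintype.card C)) ℂ :=
    Wᴴ.submatrix g id
  have hU : ∀ M, U * M * Uᴴ = (Wᴴ * M * W).submatrix g g := by
    intro M
    ext i j
    simp [U, Matrix.mul_apply]
  have hout : U * (ϱ ⊗ₖ σ) * Uᴴ = diagonal fun y : A × Fin (Fintype.card C) =>
      ((p (e (y.1, f y.2)).1 * c (e (y.1, f y.2)).2 : ℝ) : ℂ) := by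
    rw [hU, hM]
    have : Wᴴ * (W * (diagonal (fun x => (p x : ℂ)) ⊗ₖ σ) * Wᴴ) * W =
        (Wᴴ * W) * (diagonal (fun x => (p x : ℂ)) ⊗ₖ σ) * (Wᴴ * W) := by
      simp only [Matrix.mul_assoc]
    rw [this, hW, one_mul, mul_one, hσ, diagonal_kronecker_diagonal,
      submatrix_diagonal_equiv]
    congr 1
    funext ⟨x, j⟩
    simp [hg]
  refine ⟨_, σ, (hc.comp_equiv f).isDensityMatrix_diagonal, hdeph _, U, ?_, ?_, ?_⟩
  · rw [Matrix.mem_unitaryGroup_iff]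
    have := hU 1
    rw [mul_one, mul_one, hW] at this
    simpa [star_eq_conjTranspose] using this
  · rw [hout, ptrace2_diagonal]
    congr 1
    funext x
    rw [← hA x, ← Equiv.sum_comp f]
    push_cast
    rfl
  · rw [hout, ptrace1_diagonal, hdeph, hσ]
    congr 1
    funext j
    rw [← hC (f j)]
    push_cast
    rfl

lemma vN2_diagonal (y : ℝ) :
    vN2 (diagonal fun i : Fin 2 => ((if i = 0 then 1 - y else y : ℝ) : ℂ)) =
      Real.binEntropy y / Real.log 2 := by
  have hH : (diagonal fun i : Fin 2 => ((if i = 0 then 1 - y else y : ℝ) : ℂ)).IsHermitian :=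
    isHermitian_diagonal_of_self_adjoint _ (by ext i; simp)
  have htr := hH.trace_eq_sum_eigenvalues
  have hdet := hH.det_eq_prod_eigenvalues
  have htr' : hH.eigenvalues 0 + hH.eigenvalues 1 = 1 := by
    simp [trace_diagonal] at htr
    exact_mod_cast htr.symm
  have hdet' : hH.eigenvalues 0 * hH.eigenvalues 1 = (1 - y) * y := by
    simp [det_diagonal] at hdet
    exact_mod_cast hdet.symm
  have h1 : hH.eigenvalues 1 = 1 - hH.eigenvalues 0 := by linarith
  have hv : vN2 (diagonal fun i : Fin 2 => ((if i = 0 then 1 - y else y : ℝ) : ℂ)) =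
      Real.binEntropy (hH.eigenvalues 0) / Real.log 2 := by
    rw [vN2, eigs, dif_pos hH, Fin.sum_univ_two, h1,
      Real.binEntropy_eq_negMulLog_add_negMulLog_one_sub]
    simp only [Real.logb, Real.negMulLog]
    ring
  rw [hv]
  have hroot : (hH.eigenvalues 0 - y) * (hH.eigenvalues 0 - (1 - y)) = 0 := by
    rw [h1] at hdet'
    linarith
  rcases mul_eq_zero.1 hroot with h | h
  · rw [sub_eq_zero.1 h]
  · rw [sub_eq_zero.1 h, Real.binEntropy_one_sub]

/-- catalytic cooling. For a qubit state `ϱ` with `S(ϱ) < 1/2` (in bits)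
and any `ε > 0`, two copies of `ϱ` can be catalytically transformed (with a quasi-classical
catalyst returned after dephasing) into `ϱ' ⊗ 𝟙₂`, where `ϱ'` is full rank with
`0 < S(ϱ') < ε`. -/
theorem stmt14 (ϱ : Matrix (Fin 2) (Fin 2) ℂ) (hϱ : IsDensityMatrix ϱ)
    (hS : vN2 ϱ < 1/2) :
    ∀ ε > (0 : ℝ),
      ∃ ϱ' : Matrix (Fin 2) (Fin 2) ℂ,
        IsDensityMatrix ϱ' ∧ ϱ'.rank = 2 ∧ 0 < vN2 ϱ' ∧ vN2 ϱ' < ε ∧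
        ∃ (m : ℕ) (σ : Matrix (Fin m) (Fin m) ℂ),
          IsDensityMatrix σ ∧ deph σ = σ ∧
          ∃ U ∈ Matrix.unitaryGroup ((Fin 2 × Fin 2) × Fin m) ℂ,
            ptrace2 (U * ((ϱ ⊗ₖ ϱ) ⊗ₖ σ) * Uᴴ) = ϱ' ⊗ₖ mm 2 ∧
            deph (ptrace1 (U * ((ϱ ⊗ₖ ϱ) ⊗ₖ σ) * Uᴴ)) = σ := by
  intro ε hε
  have hH := hϱ.1.isHermitian
  have hl : IsProb hH.eigenvalues := by
    refine ⟨hϱ.1.eigenvalues_nonneg, ?_⟩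
    have h := hH.trace_eq_sum_eigenvalues
    rw [hϱ.2] at h
    exact Complex.ofReal_injective (by simpa using h.symm)
  have hS' : ∑ i, -(hH.eigenvalues i * Real.logb 2 (hH.eigenvalues i)) < 1 / 2 := by
    simpa only [vN2, eigs, dif_pos hH] using hS
  have hp : IsProb fun x : Fin 2 × Fin 2 => hH.eigenvalues x.1 * hH.eigenvalues x.2 := by
    refine ⟨fun x => mul_nonneg (hl.1 _) (hl.1 _), ?_⟩
    rw [Fintype.sum_prod_type]
    simp only [← Finset.mul_sum, hl.2, mul_one]
  obtain ⟨s, hs, hs1, hlt⟩ := exists_chernoff_exponent hl hS'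
  have hlog : (0 : ℝ) < Real.log 2 := Real.log_pos (by norm_num)
  have hcont : ContinuousAt (fun y => Real.binEntropy y / Real.log 2) 0 :=
    (Real.binEntropy_continuous.div_const _).continuousAt
  obtain ⟨η, hη, hηε⟩ := Metric.continuousAt_iff.1 hcont ε hε
  obtain ⟨y, hy0, hyη, hcat⟩ := exists_catConv_cool hp hs hs1 hlt (lt_min hη one_half_pos)
  obtain ⟨hy, hy1⟩ := lt_min_iff.1 hyη
  have hpos : 0 < Real.binEntropy y / Real.log 2 :=
    div_pos (Real.binEntropy_pos hy0 (by linarith)) hlog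
  have hprob : IsProb fun i : Fin 2 => if i = 0 then 1 - y else y := by
    refine ⟨fun i => ?_, by simp⟩
    dsimp only
    split_ifs <;> linarith
  obtain ⟨V, hV, hϱV⟩ := hH.exists_unitary_diagonal
  have hϱϱ : ϱ ⊗ₖ ϱ = (V ⊗ₖ V) * diagonal (fun x : Fin 2 × Fin 2 =>
      ((hH.eigenvalues x.1 * hH.eigenvalues x.2 : ℝ) : ℂ)) * (V ⊗ₖ V)ᴴ := by
    conv_lhs => rw [hϱV]
    simp only [mul_kronecker_mul, diagonal_kronecker_diagonal, conjTranspose_kronecker,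
      Complex.ofReal_mul]
  refine ⟨diagonal fun i => ((if i = 0 then 1 - y else y : ℝ) : ℂ),
    hprob.isDensityMatrix_diagonal, ?_, ?_, ?_, ?_⟩
  · rw [rank_of_isUnit, Fintype.card_fin]
    rw [isUnit_iff_isUnit_det, det_diagonal, Fin.prod_univ_two, isUnit_iff_ne_zero]
    have : (1 - y) * y ≠ 0 := mul_ne_zero (by linarith) hy0.ne'
    simpa using (by exact_mod_cast this : ((1 - y : ℂ)) * y ≠ 0)
  · rwa [vN2_diagonal]
  · rw [vN2_diagonal]
    have h := hηε (x := y) (by rwa [Real.dist_eq, sub_zero, abs_of_pos hy0])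
    rwa [Real.binEntropy_zero, zero_div, Real.dist_eq, sub_zero, abs_of_pos hpos] at h
  · obtain ⟨m, σ, hσ, hdσ, U, hU, h1, h2⟩ :=
      hcat.exists_unitary (kronecker_mem_unitary hV hV) hϱϱ
    refine ⟨m, σ, hσ, hdσ, U, hU, ?_, h2⟩
    rw [h1, mm, ← diagonal_one, ← diagonal_smul, diagonal_kronecker_diagonal]
    congr 1
    funext x
    rw [Complex.ofReal_div]
    simp [div_eq_mul_inv]
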